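/- arXiv:1707.05040 — 2 statements merged into one kernel-verified Lean document; each statement's English description precedes it below -/
import Mathlib

section
/- Let C be an abelian category with enough projectives, X an object, and k a natural number. The following are equivalent: (i) X has a Gorenstein projective resolution of length at most k; (ii) for every projective resolution P_• of X, the k-th syzygy Ω^k(P_•) is Gorenstein projective; (iii) X admits a resolution 0→P_k→⋯→P_1→G_0→X→0 with all P_i projective and G_0 Gorenstein projective. -/
open CategoryTheory CategoryTheory.Limits

universe w w' v v' u u'

section Defs

variable {C : Type u} [Category.{v} C] [Abelian C]

/-- `f`, `g` form a short exact sequence `0 → X → Y → Z → 0`. -/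
def IsSES {X Y Z : C} (f : X ⟶ Y) (g : Y ⟶ Z) : Prop :=
  ∃ w : f ≫ g = 0, (ShortComplex.mk f g w).ShortExact

/-- Vanishing of the Yoneda Ext¹ group: every short exact sequence
`0 → P → E → Z → 0` splits. -/
def YonedaExt1Zero (Z P : C) : Prop :=
  ∀ (E : C) (i : P ⟶ E) (p : E ⟶ Z), IsSES i p → ∃ s : Z ⟶ E, s ≫ p = 𝟙 Z

/-- A totally acyclic complex of projectives: an exact complex of projective
objects which stays exact after applying `Hom(-, Q)` for every projective `Q`. -/
structure IsTotallyAcyclic (P : ChainComplex C ℤ) : Prop where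
  projective : ∀ i, Projective (P.X i)
  acyclic : ∀ i, P.ExactAt i
  homExact : ∀ (Q : C), Projective Q → ∀ (i : ℤ) (f : P.X i ⟶ Q),
    P.d (i + 1) i ≫ f = 0 → ∃ g : P.X (i - 1) ⟶ Q, P.d i (i - 1) ≫ g = f

/-- An object is Gorenstein projective if it is (isomorphic to) a syzygy of a
totally acyclic complex of projectives. -/
def IsGorensteinProjective (X : C) : Prop :=
  ∃ P : ChainComplex C ℤ, IsTotallyAcyclic P ∧ Nonempty (X ≅ cokernel (P.d 1 0))

/-- `X` admits a resolution of length at most `n` by objects satisfying `S`. -/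
inductive HasResDimLE (S : C → Prop) : C → ℕ → Prop
  | of_mem {X : C} (hX : S X) (n : ℕ) : HasResDimLE S X n
  | step {X K G : C} (n : ℕ) (f : K ⟶ G) (g : G ⟶ X)
      (hses : IsSES f g) (hG : S G) (hK : HasResDimLE S K n) :
      HasResDimLE S X (n + 1)

/-- The G-dimension: the minimal length of a Gorenstein projective resolution. -/
noncomputable def gDim (X : C) : ℕ∞ :=
  sInf {n : ℕ∞ | ∃ m : ℕ, n = (m : ℕ∞) ∧ HasResDimLE IsGorensteinProjective X m}

variable [HasExt.{w} C]

/-- The projective dimension: the minimal `m` such that `Ext^j(X, -)` vanishes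
for all `j > m`. -/
noncomputable def projDim (X : C) : ℕ∞ :=
  sInf {n : ℕ∞ | ∃ m : ℕ, n = (m : ℕ∞) ∧
    ∀ (Y : C) (j : ℕ), m < j → Subsingleton (Abelian.Ext X Y j)}

/-- The injective dimension: the minimal `m` such that `Ext^j(-, X)` vanishes
for all `j > m`. -/
noncomputable def injDim (X : C) : ℕ∞ :=
  sInf {n : ℕ∞ | ∃ m : ℕ, n = (m : ℕ∞) ∧
    ∀ (Y : C) (j : ℕ), m < j → Subsingleton (Abelian.Ext Y X j)}

end Defs

open Abelian

section ShortExactSequences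

variable {C : Type u} [Category.{v} C] [Abelian C]

namespace IsSES

lemma mk_of_cokernel {A B D : C} (f : A ⟶ B) (g : B ⟶ D) [Mono f] [Epi g] (w : f ≫ g = 0)
    (h : ∀ (T : C) (k : B ⟶ T), f ≫ k = 0 → ∃ l : D ⟶ T, g ≫ l = k) : IsSES f g := by
  refine ⟨w, .mk' (ShortComplex.exact_of_g_is_cokernel _ ?_) ‹_› ‹_›⟩
  exact CokernelCofork.IsColimit.ofπ _ _ (fun k hk => (h _ k hk).choose)
    (fun k hk => (h _ k hk).choose_spec)
    (fun k hk m hm => by rw [← cancel_epi g, hm, (h _ k hk).choose_spec])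

variable {A B D : C} {f : A ⟶ B} {g : B ⟶ D}

lemma zero (h : IsSES f g) : f ≫ g = 0 := h.choose

lemma zero_assoc (h : IsSES f g) {T : C} (k : D ⟶ T) : f ≫ g ≫ k = 0 := by
  rw [← Category.assoc, h.zero, zero_comp]

lemma shortExact (h : IsSES f g) : (ShortComplex.mk f g h.zero).ShortExact := h.choose_spec

lemma mono (h : IsSES f g) : Mono f := h.shortExact.mono_f

lemma epi (h : IsSES f g) : Epi g := h.shortExact.epi_g

lemma exists_desc (h : IsSES f g) {T : C} (k : B ⟶ T) (hk : f ≫ k = 0) :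
    ∃ l : D ⟶ T, g ≫ l = k := by
  have := h.epi
  exact ⟨_, h.shortExact.exact.gIsCokernel.fac (CokernelCofork.ofπ k hk) .one⟩

lemma op (h : IsSES f g) : IsSES g.op f.op := ⟨_, h.shortExact.op⟩

lemma unop {A B D : Cᵒᵖ} {f : A ⟶ B} {g : B ⟶ D} (h : IsSES f g) : IsSES g.unop f.unop :=
  ⟨_, h.shortExact.unop⟩

lemma iso_left (h : IsSES f g) {A' : C} (e : A' ≅ A) : IsSES (e.hom ≫ f) g := by
  have := h.mono
  have := h.epi
  refine mk_of_cokernel _ _ (by simp [h.zero]) fun T k hk => h.exists_desc k ?_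
  rw [← cancel_epi e.hom, ← Category.assoc, hk, comp_zero]

lemma iso_right (h : IsSES f g) {D' : C} (e : D ≅ D') : IsSES f (g ≫ e.hom) := by
  have := h.mono
  have := h.epi
  refine mk_of_cokernel _ _ (by simp [h.zero_assoc]) fun T k hk => ?_
  obtain ⟨l, hl⟩ := h.exists_desc k hk
  exact ⟨e.inv ≫ l, by simp [hl]⟩

/-- Pushing out a short exact sequence along an arbitrary morphism. -/
lemma pushout (h : IsSES f g) {A' : C} (a : A ⟶ A') :
    IsSES (pushout.inl a f) (pushout.desc 0 g (by rw [h.zero, comp_zero])) := by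
  have := h.mono
  have := h.epi
  have : Epi (pushout.desc 0 g (by rw [h.zero, comp_zero]) : Limits.pushout a f ⟶ D) :=
    epi_of_epi_fac (pushout.inr_desc _ _ _)
  refine mk_of_cokernel _ _ (pushout.inl_desc _ _ _) fun T k hk => ?_
  obtain ⟨l, hl⟩ := h.exists_desc (pushout.inr a f ≫ k) (by
    rw [← pushout.condition_assoc, hk, comp_zero])
  refine ⟨l, pushout.hom_ext ?_ ?_⟩
  · rw [pushout.inl_desc_assoc, hk, zero_comp]
  · rw [pushout.inr_desc_assoc, hl]

/-- The pushout of two monomorphisms with given cokernels. -/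
lemma exists_pushout (h : IsSES f g) {A' D' : C} {a : A ⟶ A'} {b : A' ⟶ D'} (h' : IsSES a b) :
    ∃ (E : C) (i : A' ⟶ E) (p : E ⟶ D) (i' : B ⟶ E) (p' : E ⟶ D'),
      IsSES i p ∧ IsSES i' p' := by
  have := h.epi
  have := h'.epi
  have := h'.mono
  refine ⟨Limits.pushout a f, _, _, pushout.inr a f,
    pushout.desc b 0 (by rw [h'.zero, comp_zero]), h.pushout a, ?_⟩
  have : Epi (pushout.desc b 0 (by rw [h'.zero, comp_zero]) : Limits.pushout a f ⟶ D') :=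
    epi_of_epi_fac (pushout.inl_desc _ _ _)
  refine mk_of_cokernel _ _ (pushout.inr_desc _ _ _) fun T k hk => ?_
  obtain ⟨l, hl⟩ := h'.exists_desc (pushout.inl a f ≫ k) (by
    rw [pushout.condition_assoc, hk, comp_zero])
  refine ⟨l, pushout.hom_ext ?_ ?_⟩
  · rw [pushout.inl_desc_assoc, hl]
  · rw [pushout.inr_desc_assoc, hk, zero_comp]

/-- The pullback of two epimorphisms with given kernels. -/
lemma exists_pullback (h : IsSES f g) {A' B' : C} {f' : A' ⟶ B'} {g' : B' ⟶ D} (h' : IsSES f' g') :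
    ∃ (E : C) (i : A' ⟶ E) (p : E ⟶ B) (i' : A ⟶ E) (p' : E ⟶ B'),
      IsSES i p ∧ IsSES i' p' := by
  obtain ⟨E, i, p, i', p', h₁, h₂⟩ := h'.op.exists_pushout h.op
  exact ⟨E.unop, p.unop, i.unop, p'.unop, i'.unop, h₁.unop, h₂.unop⟩

/-- The cokernel of a composition of two monomorphisms. -/
lemma exists_comp_mono (h : IsSES f g) {B' D' : C} {i : B ⟶ B'} {p : B' ⟶ D'} (h' : IsSES i p) :
    ∃ (E : C) (q : B' ⟶ E) (j : D ⟶ E) (r : E ⟶ D'), IsSES (f ≫ i) q ∧ IsSES j r := by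
  have := h.mono
  have := h.epi
  have := h'.mono
  refine ⟨_, pushout.inr g i, _, _, ?_, h'.pushout g⟩
  refine mk_of_cokernel _ _ ?_ fun T k hk => ?_
  · rw [Category.assoc, ← pushout.condition, h.zero_assoc]
  · obtain ⟨l, hl⟩ := h.exists_desc (i ≫ k) (by simpa using hk)
    exact ⟨pushout.desc l k hl, pushout.inr_desc _ _ _⟩

/-- The kernel of a composition of two epimorphisms. -/
lemma exists_comp_epi (h : IsSES f g) {D' F : C} {i : D' ⟶ D} {p : D ⟶ F} (h' : IsSES i p) :
    ∃ (K : C) (j : A ⟶ K) (r : K ⟶ D') (q : K ⟶ B), IsSES j r ∧ IsSES q (g ≫ p) := by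
  obtain ⟨E, q, j, r, h₁, h₂⟩ := h'.op.exists_comp_mono h.op
  exact ⟨E.unop, r.unop, j.unop, q.unop, h₂.unop, h₁.unop⟩

lemma exists_swap (h : IsSES f g) (s : (ShortComplex.mk f g h.zero).Splitting) :
    ∃ (i : D ⟶ B) (p : B ⟶ A), IsSES i p := by
  refine ⟨s.s, s.r, s.s_r, ?_⟩
  exact (ShortComplex.Splitting.mk (S := ShortComplex.mk s.s s.r s.s_r) g f s.s_g s.f_r
    (by have := s.id; dsimp at this ⊢; rw [← this, add_comm])).shortExact

lemma exists_swap_of_projective (h : IsSES f g) [Projective D] :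
    ∃ (i : D ⟶ B) (p : B ⟶ A), IsSES i p :=
  h.exists_swap (@ShortComplex.ShortExact.splittingOfProjective _ _ _ _ h.shortExact ‹_› _)

lemma exists_swap_of_retraction (h : IsSES f g) (r : B ⟶ A) (hr : f ≫ r = 𝟙 A) :
    ∃ (i : D ⟶ B) (p : B ⟶ A), IsSES i p := by
  have := h.epi
  exact h.exists_swap (ShortComplex.Splitting.ofExactOfRetraction _ h.shortExact.exact r hr this)

lemma projective_of_projective (h : IsSES f g) [Projective A] [Projective D] : Projective B := by
  let s := @ShortComplex.ShortExact.splittingOfProjective _ _ _ _ h.shortExact ‹_› _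
  exact Projective.of_iso s.isoBinaryBiproduct.symm
    (show Projective (A ⊞ D) from inferInstance)

end IsSES

lemma isSES_cokernel {A B D : C} (a : A ⟶ B) (b : B ⟶ D) (w : a ≫ b = 0)
    (h : (ShortComplex.mk a b w).Exact) : IsSES (cokernel.desc a b w) (cokernel.π b) := by
  have : Mono (cokernel.desc a b w) := (ShortComplex.exact_iff_mono_cokernel_desc _).1 h
  refine IsSES.mk_of_cokernel _ _ (by ext; simp) fun T k hk => ?_
  refine ⟨cokernel.desc b k ?_, cokernel.π_desc _ _ _⟩
  rw [← cokernel.π_desc a b w, Category.assoc, hk, comp_zero]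

open scoped ZeroObject in
lemma isSES_id_zero (A : C) : IsSES (𝟙 A) (0 : A ⟶ 0) :=
  IsSES.mk_of_cokernel _ _ (by simp) fun T k hk => ⟨0, by simpa using hk.symm⟩

lemma exists_isSES_of_enoughProjectives [EnoughProjectives C] (X : C) :
    ∃ (K P : C) (f : K ⟶ P) (g : P ⟶ X), Projective P ∧ IsSES f g :=
  ⟨_, _, kernel.ι (Projective.π X), _, inferInstance, by simp,
    .mk' (ShortComplex.exact_kernel _) inferInstance inferInstance⟩

end ShortExactSequences

section GorensteinProjective

variable {C : Type u} [Category.{v} C] [Abelian C]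

/-- The groups `Extⁱ(X, Q)` vanish for all `i > 0` and all projective objects `Q`. -/
def ExtProjVanishing [HasExt.{w} C] (X : C) : Prop :=
  ∀ (Q : C), Projective Q → ∀ n : ℕ, Subsingleton (Ext.{w} X Q (n + 1))

lemma Projective.extProjVanishing [HasExt.{w} C] (X : C) [Projective X] :
    ExtProjVanishing.{w} X :=
  fun Q _ n => Ext.subsingleton_of_projective X Q n

namespace IsSES

variable [HasExt.{w} C] {A B D : C} {f : A ⟶ B} {g : B ⟶ D}

lemma extProjVanishing_left (h : IsSES f g) (hB : ExtProjVanishing.{w} B)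
    (hD : ExtProjVanishing.{w} D) :
    ExtProjVanishing.{w} A := by
  refine fun Q hQ n => subsingleton_of_forall_eq 0 fun e => ?_
  have := hB Q hQ n
  have := hD Q hQ (n + 1)
  obtain ⟨x, rfl⟩ := Ext.contravariant_sequence_exact₁ h.shortExact Q e (add_comm _ _)
    (Subsingleton.elim _ _)
  rw [Subsingleton.elim x 0, Ext.comp_zero]

lemma extProjVanishing_mid (h : IsSES f g) (hA : ExtProjVanishing.{w} A)
    (hD : ExtProjVanishing.{w} D) :
    ExtProjVanishing.{w} B := by
  refine fun Q hQ n => subsingleton_of_forall_eq 0 fun e => ?_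
  have := hA Q hQ n
  have := hD Q hQ n
  obtain ⟨x, rfl⟩ := Ext.contravariant_sequence_exact₂ h.shortExact Q e
    (Subsingleton.elim _ _)
  rw [Subsingleton.elim x 0, Ext.comp_zero]

lemma exists_extension (h : IsSES f g) (hD : ExtProjVanishing.{w} D) {Q : C}
    [hQ : Projective Q] (k : A ⟶ Q) :
    ∃ l : B ⟶ Q, f ≫ l = k := by
  have := hD Q hQ 0
  obtain ⟨x, hx⟩ := Ext.contravariant_sequence_exact₁ h.shortExact Q (Ext.mk₀ k)
    (zero_add 1) (Subsingleton.elim _ _)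
  obtain ⟨l, rfl⟩ := Ext.homEquiv₀.symm.surjective x
  refine ⟨l, Ext.homEquiv₀.symm.injective ?_⟩
  simpa using hx

lemma subsingleton_ext_one (h : IsSES f g) [Projective B] {Q : C}
    (hQ : ∀ k : A ⟶ Q, ∃ l : B ⟶ Q, f ≫ l = k) : Subsingleton (Ext.{w} D Q 1) := by
  refine subsingleton_of_forall_eq 0 fun e => ?_
  obtain ⟨x, rfl⟩ := Ext.contravariant_sequence_exact₃ h.shortExact Q e
    (Ext.eq_zero_of_projective _) (add_zero 1)
  obtain ⟨k, rfl⟩ := Ext.homEquiv₀.symm.surjective x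
  obtain ⟨l, rfl⟩ := hQ k
  have := Ext.mk₀_comp_mk₀ f l
  simp only [Ext.homEquiv₀_symm_apply]
  rw [← this, ShortComplex.ShortExact.extClass_comp_assoc]

lemma subsingleton_ext_succ (h : IsSES f g) [Projective B] {Q : C} {n : ℕ}
    (hA : Subsingleton (Ext.{w} A Q (n + 1))) : Subsingleton (Ext.{w} D Q (n + 1 + 1)) := by
  refine subsingleton_of_forall_eq 0 fun e => ?_
  obtain ⟨x, rfl⟩ := Ext.contravariant_sequence_exact₃ h.shortExact Q e
    (Ext.eq_zero_of_projective _) (add_comm 1 (n + 1))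
  rw [Subsingleton.elim x 0, Ext.comp_zero]

end IsSES

lemma exists_int_chain {α : Type*} (r : α → α → Prop) (p q : α → Prop)
    (hp : ∀ a, p a → ∃ b, p b ∧ r a b) (hq : ∀ a, q a → ∃ b, q b ∧ r b a)
    (hqp : ∀ a, q a → p a) (a : α) (ha : q a) :
    ∃ Y : ℤ → α, Y 0 = a ∧ ∀ i, p (Y i) ∧ r (Y i) (Y (i + 1)) := by
  choose s hs hs' using fun x : Subtype p => hp x.1 x.2
  choose t ht ht' using fun x : Subtype q => hq x.1 x.2
  let S : Subtype p → Subtype p := fun x => ⟨s x, hs x⟩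
  let T : Subtype q → Subtype q := fun x => ⟨t x, ht x⟩
  let Y : ℤ → α
    | .ofNat n => (S^[n] ⟨a, hqp a ha⟩).1
    | .negSucc n => (T^[n + 1] ⟨a, ha⟩).1
  refine ⟨Y, rfl, fun i => ?_⟩
  match i with
  | .ofNat n =>
    refine ⟨(S^[n] _).2, ?_⟩
    change r (S^[n] _).1 (S^[n + 1] _).1
    rw [Function.iterate_succ_apply']
    exact hs' _
  | .negSucc 0 => exact ⟨hqp _ (T _).2, ht' _⟩
  | .negSucc (n + 1) =>
    refine ⟨hqp _ (T^[n + 1 + 1] _).2, ?_⟩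
    change r (T^[n + 1 + 1] _).1 (T^[n + 1] _).1
    rw [Function.iterate_succ_apply' T (n + 1)]
    exact ht' _

/-- A class of objects with vanishing `Ext` groups into projectives which is closed under
taking suitable cosyzygies. -/
def IsCosyzygyClosed [HasExt.{w} C] (S : C → Prop) : Prop :=
  ∀ X, S X → ExtProjVanishing.{w} X ∧
    ∃ (P Y : C) (i : X ⟶ P) (p : P ⟶ Y), Projective P ∧ IsSES i p ∧ S Y

lemma exact_splice {A₂ A₁ A₀ Y₂ Y₁ : C} (g₂ : A₂ ⟶ Y₂) (f₁ : Y₂ ⟶ A₁) (g₁ : A₁ ⟶ Y₁)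
    (f₀ : Y₁ ⟶ A₀) [Epi g₂] [Mono f₀] (h : IsSES f₁ g₁) {d₁ : A₂ ⟶ A₁} {d₀ : A₁ ⟶ A₀}
    (h₁ : d₁ = g₂ ≫ f₁) (h₀ : d₀ = g₁ ≫ f₀) (w : d₁ ≫ d₀ = 0) :
    (ShortComplex.mk d₁ d₀ w).Exact := by
  subst h₁ h₀
  let S : ShortComplex C := ShortComplex.mk (g₂ ≫ f₁) g₁ (by simp [h.zero])
  let φ : S ⟶ ShortComplex.mk f₁ g₁ h.zero := { τ₁ := g₂, τ₂ := 𝟙 _, τ₃ := 𝟙 _ }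
  let ψ : S ⟶ ShortComplex.mk _ _ w := { τ₁ := 𝟙 _, τ₂ := 𝟙 _, τ₃ := f₀ }
  have : Epi φ.τ₁ := ‹_›
  have : IsIso φ.τ₂ := inferInstanceAs (IsIso (𝟙 _))
  have : Mono φ.τ₃ := inferInstanceAs (Mono (𝟙 _))
  have : Epi ψ.τ₁ := inferInstanceAs (Epi (𝟙 _))
  have : IsIso ψ.τ₂ := inferInstanceAs (IsIso (𝟙 _))
  have : Mono ψ.τ₃ := ‹_›
  rw [← ShortComplex.exact_iff_of_epi_of_isIso_of_mono ψ,
    ShortComplex.exact_iff_of_epi_of_isIso_of_mono φ]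
  exact h.shortExact.exact

lemma isTotallyAcyclic_of [HasExt.{w} C] (Y P : ℤ → C) (f : ∀ i, Y (i + 1) ⟶ P i)
    (g : ∀ i, P i ⟶ Y i) (hP : ∀ i, Projective (P i)) (h : ∀ i, IsSES (f i) (g i))
    (hY : ∀ i, ExtProjVanishing.{w} (Y i))
    (w : ∀ i, (g (i + 1 + 1) ≫ f (i + 1)) ≫ g (i + 1) ≫ f i = 0) :
    IsTotallyAcyclic (ChainComplex.of P (fun i => g (i + 1) ≫ f i) w) where
  projective := hP
  acyclic i := by
    obtain ⟨j, rfl⟩ : ∃ j, i = j + 1 := ⟨i - 1, by simp⟩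
    rw [HomologicalComplex.exactAt_iff' _ (j + 1 + 1) (j + 1) j (by simp) (by simp)]
    have := (h (j + 1 + 1)).epi
    have := (h j).mono
    exact exact_splice (g (j + 1 + 1)) (f (j + 1)) (g (j + 1)) (f j) (h (j + 1))
      (ChainComplex.of_d P (fun i => g (i + 1) ≫ f i) _)
      (ChainComplex.of_d P (fun i => g (i + 1) ≫ f i) _) _
  homExact Q hQ i := by
    obtain ⟨j, rfl⟩ : ∃ j, i = j + 1 := ⟨i - 1, by simp⟩
    rw [add_sub_cancel_right]
    intro k hk
    have := (h (j + 1 + 1)).epi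
    have hd (i : ℤ) :
        (ChainComplex.of P (fun i => g (i + 1) ≫ f i) w).d (i + 1) i = g (i + 1) ≫ f i :=
      ChainComplex.of_d P (fun i => g (i + 1) ≫ f i) _
    rw [hd, Category.assoc] at hk
    obtain ⟨l, hl⟩ := (h (j + 1)).exists_desc k (by
      rw [← cancel_epi (g (j + 1 + 1)), comp_zero]
      exact hk)
    obtain ⟨m, hm⟩ := (h j).exists_extension (hY j) l
    refine ⟨m, ?_⟩
    rw [hd, Category.assoc]
    exact (congrArg _ hm).trans hl

lemma IsCosyzygyClosed.isGorensteinProjective [HasExt.{w} C] [EnoughProjectives C]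
    {S : C → Prop} (hS : IsCosyzygyClosed.{w} S) {X : C} (hX : S X) :
    IsGorensteinProjective X := by
  obtain ⟨Y, rfl, hY⟩ := exists_int_chain
    (fun A B : C => ∃ (P : C) (f : B ⟶ P) (g : P ⟶ A), Projective P ∧ IsSES f g)
    ExtProjVanishing.{w} S
    (fun A hA => by
      obtain ⟨K, P, f, g, hP, h⟩ := exists_isSES_of_enoughProjectives A
      exact ⟨K, h.extProjVanishing_left (Projective.extProjVanishing P) hA, P, f, g, hP, h⟩)
    (fun A hA => by
      obtain ⟨-, P, Y, i, p, hP, h, hY⟩ := hS A hA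
      exact ⟨Y, hY, P, i, p, hP, h⟩)
    (fun A hA => (hS A hA).1) X hX
  choose hY P f g hP h using hY
  refine ⟨_, isTotallyAcyclic_of Y P f g hP h hY
    (fun i => by simp [(h (i + 1)).zero_assoc]), ?_⟩
  have := (h (0 + 1)).epi
  have := (h 0).epi
  have e : Y 0 ≅ cokernel (f 0) :=
    IsColimit.coconePointUniqueUpToIso ((h 0).shortExact.exact.gIsCokernel)
      (colimit.isColimit (parallelPair (f 0) 0))
  have e' : cokernel (g (0 + 1) ≫ f 0) ≅ cokernel (f 0) := cokernelEpiComp _ _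
  refine ⟨e ≪≫ e'.symm ≪≫ cokernelIsoOfEq ?_⟩
  exact (ChainComplex.of_d P (fun i => g (i + 1) ≫ f i) 0).symm

namespace IsTotallyAcyclic

variable {P : ChainComplex C ℤ}

lemma isSES (hP : IsTotallyAcyclic P) (i : ℤ) :
    IsSES (cokernel.desc (P.d (i + 1 + 1) (i + 1)) (P.d (i + 1) i) (P.d_comp_d _ _ _))
      (cokernel.π (P.d (i + 1) i)) :=
  isSES_cokernel _ _ _ ((HomologicalComplex.exactAt_iff' _ (i + 1 + 1) (i + 1) i
    (by simp) (by simp)).1 (hP.acyclic (i + 1)))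

lemma extProjVanishing [HasExt.{w} C] (hP : IsTotallyAcyclic P) (i : ℤ) :
    ExtProjVanishing.{w} (cokernel (P.d (i + 1) i)) := by
  intro Q hQ n
  have := hP.projective
  induction n generalizing i with
  | zero =>
    refine (hP.isSES i).subsingleton_ext_one fun k => ?_
    have H := hP.homExact Q hQ (i + 1) (cokernel.π _ ≫ k) (by simp)
    rw [add_sub_cancel_right] at H
    obtain ⟨l, hl⟩ := H
    exact ⟨l, by ext; simpa using hl⟩
  | succ n ih => exact (hP.isSES i).subsingleton_ext_succ (ih (i + 1))

end IsTotallyAcyclic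

lemma IsGorensteinProjective.of_iso {X Y : C} (e : X ≅ Y) (hY : IsGorensteinProjective Y) :
    IsGorensteinProjective X := by
  obtain ⟨P, hP, ⟨e'⟩⟩ := hY
  exact ⟨P, hP, ⟨e ≪≫ e'⟩⟩

lemma isCosyzygyClosed_isGorensteinProjective [HasExt.{w} C] [EnoughProjectives C] :
    IsCosyzygyClosed.{w} (IsGorensteinProjective : C → Prop) := by
  have H (P : ChainComplex C ℤ) (hP : IsTotallyAcyclic P) : IsCosyzygyClosed.{w}
      (fun X => ∃ i, Nonempty (X ≅ cokernel (P.d (i + 1) i))) := by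
    rintro X ⟨i, ⟨e⟩⟩
    obtain ⟨j, rfl⟩ : ∃ j, i = j + 1 := ⟨i - 1, by simp⟩
    have h := (hP.isSES j).iso_left e
    have := hP.projective
    exact ⟨h.extProjVanishing_left (Projective.extProjVanishing _) (hP.extProjVanishing j),
      _, _, _, _, hP.projective j, h, j, ⟨Iso.refl _⟩⟩
  rintro X ⟨P, hP, e⟩
  obtain ⟨h₁, Q, Y, i, p, hQ, h, hY⟩ := H P hP X ⟨0, e⟩
  exact ⟨h₁, Q, Y, i, p, hQ, h, (H P hP).isGorensteinProjective hY⟩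

lemma IsGorensteinProjective.extProjVanishing [HasExt.{w} C] [EnoughProjectives C] {X : C}
    (hX : IsGorensteinProjective X) : ExtProjVanishing.{w} X :=
  (isCosyzygyClosed_isGorensteinProjective X hX).1

section

variable [EnoughProjectives C]

lemma IsGorensteinProjective.exists_cosyzygy {X : C} (hX : IsGorensteinProjective X) :
    ∃ (P Y : C) (i : X ⟶ P) (p : P ⟶ Y),
      Projective P ∧ IsSES i p ∧ IsGorensteinProjective Y :=
  have := HasExt.standard C
  (isCosyzygyClosed_isGorensteinProjective X hX).2

open scoped ZeroObject in
lemma Projective.isGorensteinProjective (P : C) [hP : Projective P] :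
    IsGorensteinProjective P :=
  have := HasExt.standard C
  IsCosyzygyClosed.isGorensteinProjective (S := fun P => Projective P)
    (fun P hP => ⟨Projective.extProjVanishing P, P, 0, _, _, hP, isSES_id_zero P,
      inferInstance⟩) hP

namespace IsSES

variable {A B D : C} {f : A ⟶ B} {g : B ⟶ D}

/-- Gorenstein projective objects are closed under extensions. -/
lemma isGorensteinProjective_mid (h : IsSES f g) (hA : IsGorensteinProjective A)
    (hD : IsGorensteinProjective D) : IsGorensteinProjective B := by
  have := HasExt.standard C
  refine IsCosyzygyClosed.isGorensteinProjective (S := fun B => ∃ (A D : C) (f : A ⟶ B)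
    (g : B ⟶ D), IsSES f g ∧ IsGorensteinProjective A ∧ IsGorensteinProjective D) ?_
    ⟨A, D, f, g, h, hA, hD⟩
  rintro B ⟨A, D, f, g, h, hA, hD⟩
  refine ⟨h.extProjVanishing_mid hA.extProjVanishing hD.extProjVanishing, ?_⟩
  obtain ⟨P, A', _, _, hP, hPA, hA'⟩ := hA.exists_cosyzygy
  obtain ⟨R, D', _, _, hR, hRD, hD'⟩ := hD.exists_cosyzygy
  obtain ⟨E, _, _, _, _, hPE, hBE⟩ := h.exists_pushout hPA
  obtain ⟨r, hr⟩ := hPE.exists_extension hD.extProjVanishing (𝟙 P)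
  obtain ⟨_, _, hDE⟩ := hPE.exists_swap_of_retraction r hr
  obtain ⟨F, _, _, _, _, hRF, hEF⟩ := hDE.exists_pushout hRD
  obtain ⟨B', _, _, _, hBF, hAB'⟩ := hBE.exists_comp_mono hEF
  exact ⟨F, B', _, _, hRF.projective_of_projective, hBF, A', D', _, _, hAB', hA', hD'⟩

/-- Gorenstein projective objects are closed under kernels of epimorphisms. -/
lemma isGorensteinProjective_left (h : IsSES f g) (hB : IsGorensteinProjective B)
    (hD : IsGorensteinProjective D) : IsGorensteinProjective A := by
  have := HasExt.standard C
  obtain ⟨P, B', _, _, hP, hPB, hB'⟩ := hB.exists_cosyzygy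
  obtain ⟨E, _, _, _, hAP, hDE⟩ := h.exists_comp_mono hPB
  refine IsCosyzygyClosed.isGorensteinProjective
    (S := fun X => IsGorensteinProjective X ∨ X = A) ?_ (Or.inr rfl)
  rintro X (hX | rfl)
  · obtain ⟨P, Y, i, p, hP, h, hY⟩ := hX.exists_cosyzygy
    exact ⟨hX.extProjVanishing, P, Y, i, p, hP, h, Or.inl hY⟩
  · exact ⟨h.extProjVanishing_left hB.extProjVanishing hD.extProjVanishing, P, E, _, _, hP, hAP,
      Or.inl (hDE.isGorensteinProjective_mid hD hB')⟩

end IsSES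

end

end GorensteinProjective

section ResolutionDimension

variable {C : Type u} [Category.{v} C] [Abelian C]

namespace HasResDimLE

lemma mem_of_zero {S : C → Prop} {X : C} (h : HasResDimLE S X 0) : S X := by
  cases h
  assumption

lemma mono {S T : C → Prop} (hST : ∀ X, S X → T X) {X : C} {n : ℕ} (h : HasResDimLE S X n) :
    HasResDimLE T X n := by
  induction h with
  | of_mem hX n => exact of_mem (hST _ hX) n
  | step n f g hses hG _ ih => exact step n f g hses (hST _ hG) ih

lemma of_iso {S : C → Prop} (hS : ∀ X Y : C, (X ≅ Y) → S Y → S X) {X Y : C} (e : X ≅ Y) {n : ℕ}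
    (h : HasResDimLE S Y n) : HasResDimLE S X n := by
  cases h with
  | of_mem hY => exact of_mem (hS _ _ e hY) n
  | step n f g hses hG hK => exact step n f _ (hses.iso_right e.symm) hG hK

variable [EnoughProjectives C]

lemma kernel {K E G : C} {n : ℕ} (hE : HasResDimLE IsGorensteinProjective E n) {f : K ⟶ E}
    {g : E ⟶ G} (h : IsSES f g) (hG : IsGorensteinProjective G) :
    HasResDimLE IsGorensteinProjective K n := by
  cases hE with
  | of_mem hE => exact of_mem (h.isGorensteinProjective_left hE hG) n
  | step n _ _ hses hG' hE' =>
    obtain ⟨L, _, _, _, hL, hLG⟩ := hses.exists_comp_epi h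
    exact step n _ _ hL (hLG.isGorensteinProjective_left hG' hG) hE'

lemma extension {K E P : C} [Projective P] {n : ℕ}
    (hK : HasResDimLE IsGorensteinProjective K n) {f : K ⟶ E} {g : E ⟶ P} (h : IsSES f g) :
    HasResDimLE IsGorensteinProjective E n := by
  have hP := Projective.isGorensteinProjective P
  cases hK with
  | of_mem hK => exact of_mem (h.isGorensteinProjective_mid hK hP) n
  | step n _ _ hses hG hK' =>
    obtain ⟨_, _, h'⟩ := h.exists_swap_of_projective
    obtain ⟨F, _, _, _, _, hF, hF'⟩ := h'.exists_pullback hses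
    exact step n _ _ hF (hF'.isGorensteinProjective_mid hP hG) hK'

lemma syzygy {K P X : C} [Projective P] {n : ℕ}
    (hX : HasResDimLE IsGorensteinProjective X (n + 1)) {f : K ⟶ P} {g : P ⟶ X}
    (h : IsSES f g) : HasResDimLE IsGorensteinProjective K n := by
  cases hX with
  | of_mem hX =>
    exact of_mem
      (h.isGorensteinProjective_left (Projective.isGorensteinProjective P) hX) n
  | step n _ _ hses hG hK =>
    obtain ⟨E, _, _, _, _, hE, hE'⟩ := h.exists_pullback hses
    exact (hK.extension hE).kernel hE' hG

/-- An object of G-dimension at most `n` embeds into an object of projective dimension at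
most `n` with Gorenstein projective cokernel. -/
lemma exists_hull {X : C} {n : ℕ} (h : HasResDimLE IsGorensteinProjective X n) :
    ∃ (L H : C) (f : X ⟶ L) (g : L ⟶ H), IsSES f g ∧ IsGorensteinProjective H ∧
      HasResDimLE (fun Q : C => Projective Q) L n := by
  induction h with
  | of_mem hX n =>
    obtain ⟨P, Y, i, p, hP, h, hY⟩ := hX.exists_cosyzygy
    exact ⟨P, Y, i, p, h, hY, of_mem hP n⟩
  | step n _ _ hses hG _ ih =>
    obtain ⟨L, H, _, _, hL, hH, hL'⟩ := ih
    obtain ⟨E, _, _, _, _, hLE, hGE⟩ := hses.exists_pushout hL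
    obtain ⟨P, E', _, _, hP, hEP, hE'⟩ :=
      (hGE.isGorensteinProjective_mid hG hH).exists_cosyzygy
    obtain ⟨L', _, _, _, hLP, hXL'⟩ := hLE.exists_comp_mono hEP
    exact ⟨L', E', _, _, hXL', hE', step n _ _ hLP hP hL'⟩

open scoped ZeroObject in
/-- An object of G-dimension at most `n + 1` has a Gorenstein projective approximation whose
kernel has projective dimension at most `n`. -/
lemma exists_approximation {X : C} {n : ℕ}
    (h : HasResDimLE IsGorensteinProjective X (n + 1)) :
    ∃ (K G : C) (f : K ⟶ G) (g : G ⟶ X), IsSES f g ∧ IsGorensteinProjective G ∧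
      HasResDimLE (fun Q : C => Projective Q) K n := by
  cases h with
  | of_mem hX =>
    obtain ⟨i, p, h⟩ := (isSES_id_zero X).exists_swap_of_projective
    exact ⟨0, X, i, p, h, hX, of_mem
      (S := fun Q : C => Projective Q) (inferInstanceAs (Projective (0 : C))) n⟩
  | step n _ _ hses hG hK =>
    obtain ⟨L, H, _, _, hL, hH, hL'⟩ := hK.exists_hull
    obtain ⟨E, _, _, _, _, hLE, hGE⟩ := hses.exists_pushout hL
    exact ⟨L, E, _, _, hLE, hGE.isGorensteinProjective_mid hG hH, hL'⟩

end HasResDimLE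

namespace CategoryTheory.ProjectiveResolution

variable {X : C} (P : ProjectiveResolution X)

lemma isSES_syzygy (j : ℕ) :
    IsSES (cokernel.desc (P.complex.d (j + 1 + 1) (j + 1)) (P.complex.d (j + 1) j)
      (P.complex.d_comp_d _ _ _)) (cokernel.π (P.complex.d (j + 1) j)) :=
  isSES_cokernel _ _ _ (P.exact_succ j)

lemma nonempty_iso_syzygy_zero : Nonempty (cokernel (P.complex.d 1 0) ≅ X) :=
  ⟨(colimit.isColimit (parallelPair (P.complex.d 1 0) 0)).coconePointUniqueUpToIso
    P.isColimitCokernelCofork⟩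

lemma hasResDimLE_syzygy_iff [EnoughProjectives C] (j n : ℕ) :
    HasResDimLE IsGorensteinProjective (cokernel (P.complex.d (j + 1) j)) n ↔
      HasResDimLE IsGorensteinProjective X (n + j) := by
  induction j generalizing n with
  | zero =>
    obtain ⟨e⟩ := P.nonempty_iso_syzygy_zero
    exact ⟨.of_iso (fun _ _ => .of_iso) e.symm, .of_iso (fun _ _ => .of_iso) e⟩
  | succ j ih =>
    rw [← add_assoc, add_right_comm n j 1, ← ih]
    exact ⟨.step n _ _ (P.isSES_syzygy j) (Projective.isGorensteinProjective _),
      fun h => h.syzygy (P.isSES_syzygy j)⟩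

end CategoryTheory.ProjectiveResolution

end ResolutionDimension

/-- Characterisations of objects of G-dimension at most `k`. -/
theorem gdim_le_characterisations {C : Type u} [Category.{v} C] [Abelian C]
    [EnoughProjectives C] (X : C) (k : ℕ) :
    (HasResDimLE IsGorensteinProjective X k ↔
      ∀ P : ProjectiveResolution X,
        IsGorensteinProjective (cokernel (P.complex.d (k + 1) k))) ∧
    (HasResDimLE IsGorensteinProjective X k ↔
      (match k with
        | 0 => IsGorensteinProjective X
        | n + 1 => ∃ (K G : C) (f : K ⟶ G) (g : G ⟶ X),
            IsSES f g ∧ IsGorensteinProjective G ∧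
            HasResDimLE (fun Q : C => Projective Q) K n)) := by
  have resolution_iff (P : ProjectiveResolution X) :
      IsGorensteinProjective (cokernel (P.complex.d (k + 1) k)) ↔
        HasResDimLE IsGorensteinProjective X k := by
    rw [← zero_add k, ← P.hasResDimLE_syzygy_iff, zero_add]
    exact ⟨fun h => .of_mem h 0, HasResDimLE.mem_of_zero⟩
  refine ⟨⟨fun h P => (resolution_iff P).2 h,
    fun h => (resolution_iff (projectiveResolution X)).1 (h _)⟩, ?_⟩
  cases k with
  | zero => exact ⟨HasResDimLE.mem_of_zero, fun h : IsGorensteinProjective X => .of_mem h 0⟩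
  | succ n =>
    refine ⟨HasResDimLE.exists_approximation, ?_⟩
    rintro ⟨K, G, f, g, h, hG, hK⟩
    exact .step n f g h hG (hK.mono fun P (_ : Projective P) => Projective.isGorensteinProjective P)
end

section
/- Let C be an abelian category with enough projectives. For every object X, the G-dimension of X is at most the projective dimension of X, and if the projective dimension of X is finite, then Gd_C X = pd_C X. -/
open CategoryTheory CategoryTheory.Limits

universe w w' v v' u u'

section Helpers

open Abelian

variable {C : Type u} [Category.{v} C] [Abelian C]

/-- The square-zero endomorphism `(x, y) ↦ (0, x)` of `P ⊞ P`. -/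
noncomputable abbrev biprodShift (P : C) : P ⊞ P ⟶ P ⊞ P := biprod.fst ≫ biprod.inr

lemma biprodShift_comp_self (P : C) : biprodShift P ≫ biprodShift P = 0 := by simp

lemma inr_comp_eq_zero_of_biprodShift_comp {P Q : C} {f : P ⊞ P ⟶ Q}
    (hf : biprodShift P ≫ f = 0) : biprod.inr ≫ f = 0 := by
  simpa [← cancel_epi (biprod.fst : P ⊞ P ⟶ P)] using hf

lemma exact_biprodShift (P : C) :
    (ShortComplex.mk _ _ (biprodShift_comp_self P)).Exact := by
  rw [ShortComplex.exact_iff_exact_up_to_refinements]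
  intro A (x : A ⟶ P ⊞ P) (hx : x ≫ biprodShift P = 0)
  have hfst : x ≫ biprod.fst = 0 := by
    simpa only [biprodShift, Category.assoc, biprod.inr_snd, Category.comp_id, zero_comp]
      using hx =≫ biprod.snd
  refine ⟨A, 𝟙 A, inferInstance, x ≫ biprod.snd ≫ biprod.inl, ?_⟩
  change 𝟙 A ≫ x = (x ≫ biprod.snd ≫ biprod.inl) ≫ biprodShift P
  apply biprod.hom_ext <;> simp [hfst]

lemma exists_biprodShift_comp_eq {P Q : C} (f : P ⊞ P ⟶ Q) (hf : biprodShift P ≫ f = 0) :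
    ∃ g : P ⊞ P ⟶ Q, biprodShift P ≫ g = f :=
  ⟨biprod.snd ≫ biprod.inl ≫ f, by
    apply biprod.hom_ext' <;> simp [inr_comp_eq_zero_of_biprodShift_comp hf]⟩

/-- The cokernel of `(x, y) ↦ (0, x)` on `P ⊞ P` is `P`. -/
noncomputable def isoCokernelBiprodShift (P : C) : P ≅ cokernel (biprodShift P) where
  hom := biprod.inl ≫ cokernel.π (biprodShift P)
  inv := cokernel.desc _ biprod.fst (by simp)
  inv_hom_id := by
    have := inr_comp_eq_zero_of_biprodShift_comp (cokernel.condition (biprodShift P))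
    rw [← cancel_epi (cokernel.π _), cokernel.π_desc_assoc, Category.comp_id]
    apply biprod.hom_ext' <;> simp [this]

/-- The contractible complex of `P ⊞ P` with differential `(x, y) ↦ (0, x)`. -/
noncomputable def contractibleComplex (P : C) : ChainComplex C ℤ where
  X _ := P ⊞ P
  d i j := if j + 1 = i then biprodShift P else 0
  shape _ _ h := if_neg h
  d_comp_d' i j k _ _ := by split_ifs <;> simp

lemma contractibleComplex_d (P : C) {i j : ℤ} (h : j + 1 = i) :
    (contractibleComplex P).d i j = biprodShift P := if_pos h

lemma isTotallyAcyclic_contractibleComplex (P : C) [Projective P] :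
    IsTotallyAcyclic (contractibleComplex P) where
  projective _ := inferInstanceAs (Projective (P ⊞ P))
  acyclic i := by
    rw [HomologicalComplex.exactAt_iff' _ (i + 1) i (i - 1) (by simp) (by simp)]
    refine ShortComplex.exact_of_iso (ShortComplex.isoMk (Iso.refl (P ⊞ P)) (Iso.refl (P ⊞ P))
      (Iso.refl (P ⊞ P)) ?_ ?_) (exact_biprodShift P)
    · exact (Category.id_comp _).trans
        ((contractibleComplex_d P rfl).trans (Category.comp_id _).symm)
    · exact (Category.id_comp _).trans
        ((contractibleComplex_d P (by lia)).trans (Category.comp_id _).symm)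
  homExact Q _ i f hf := by
    rw [contractibleComplex_d P rfl] at hf
    rw [contractibleComplex_d P (by lia)]
    exact exists_biprodShift_comp_eq f hf

lemma isGorensteinProjective_of_projective (P : C) [Projective P] :
    IsGorensteinProjective P :=
  ⟨contractibleComplex P, isTotallyAcyclic_contractibleComplex P,
    ⟨isoCokernelBiprodShift P ≪≫ cokernelIsoOfEq (contractibleComplex_d P rfl).symm⟩⟩

lemma HasResDimLE.mono_s12 {S T : C → Prop} (h : ∀ X, S X → T X) {X : C} {n : ℕ}
    (hX : HasResDimLE S X n) : HasResDimLE T X n := by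
  induction hX with
  | of_mem hX n => exact .of_mem (h _ hX) n
  | step n f g hses hG _ ih => exact .step n f g hses (h _ hG) ih

lemma hasResDimLE_projective [EnoughProjectives C] (n : ℕ) (X : C)
    [hX : HasProjectiveDimensionLE X n] :
    HasResDimLE (fun P : C ↦ Projective P) X n := by
  induction n generalizing X with
  | zero => exact .of_mem ((projective_iff_hasProjectiveDimensionLE_zero X).2 hX) 0
  | succ n ih =>
    have hses : (ShortComplex.mk (kernel.ι (Projective.π X)) (Projective.π X)
        (kernel.condition _)).ShortExact := { exact := ShortComplex.exact_kernel _ }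
    have := (hses.hasProjectiveDimensionLT_X₃_iff n (Projective.projective_over X)).1 hX
    exact .step n _ _ ⟨_, hses⟩ (Projective.projective_over X) (ih _ (hX := this))

lemma shortExact_cokernel_of_exactAt (P : ChainComplex C ℤ) (i : ℤ) (h : P.ExactAt (i + 1)) :
    (ShortComplex.mk
      (cokernel.desc (P.d (i + 1 + 1) (i + 1)) (P.d (i + 1) i) (P.d_comp_d _ _ _))
      (cokernel.π (P.d (i + 1) i)) (by simp [← cancel_epi (cokernel.π _)])).ShortExact := by
  rw [HomologicalComplex.exactAt_iff' _ (i + 1 + 1) (i + 1) i (by simp) (by simp),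
    ShortComplex.exact_iff_mono_cokernel_desc] at h
  have : Mono (cokernel.desc (P.d (i + 1 + 1) (i + 1)) (P.d (i + 1) i) (P.d_comp_d _ _ _)) := h
  refine { exact := ?_ }
  let φ : ShortComplex.mk _ _ (cokernel.condition (P.d (i + 1) i)) ⟶ ShortComplex.mk
      (cokernel.desc (P.d (i + 1 + 1) (i + 1)) (P.d (i + 1) i) (P.d_comp_d _ _ _))
      (cokernel.π (P.d (i + 1) i)) (by simp [← cancel_epi (cokernel.π _)]) :=
    { τ₁ := cokernel.π _, τ₂ := 𝟙 _, τ₃ := 𝟙 _ }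
  have : Epi φ.τ₁ := inferInstanceAs (Epi (cokernel.π _))
  have : IsIso φ.τ₂ := inferInstanceAs (IsIso (𝟙 _))
  have : Mono φ.τ₃ := inferInstanceAs (Mono (𝟙 _))
  exact (ShortComplex.exact_iff_of_epi_of_isIso_of_mono φ).1 (ShortComplex.exact_cokernel _)

variable [HasExt.{w} C]

lemma IsTotallyAcyclic.ext_cokernel_eq_zero {P : ChainComplex C ℤ} (hP : IsTotallyAcyclic P)
    (Q : C) [hQ : Projective Q] (n : ℕ) (i : ℤ)
    (e : Ext (cokernel (P.d (i + 1) i)) Q (n + 1)) : e = 0 := by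
  have hS := shortExact_cokernel_of_exactAt P i (hP.acyclic _)
  have := hP.projective i
  induction n generalizing i with
  | zero =>
    obtain ⟨x, rfl⟩ := Ext.contravariant_sequence_exact₃ hS _ e
      (Ext.eq_zero_of_projective (P := P.X i) _) (add_comm 1 0)
    obtain ⟨f, rfl⟩ := Ext.homEquiv₀.symm.surjective x
    obtain ⟨g, hg⟩ : ∃ g : P.X i ⟶ Q, P.d (i + 1) i ≫ g = cokernel.π _ ≫ f := by
      have := hP.homExact Q hQ (i + 1) (cokernel.π _ ≫ f) (by simp)
      rwa [add_sub_cancel_right] at this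
    have hfg : f = cokernel.desc (P.d (i + 1 + 1) (i + 1)) (P.d (i + 1) i)
        (P.d_comp_d _ _ _) ≫ g := by
      rw [← cancel_epi (cokernel.π _), ← hg, cokernel.π_desc_assoc]
    rw [Ext.homEquiv₀_symm_apply, hfg, ← Ext.mk₀_comp_mk₀]
    exact hS.extClass_comp_assoc _
  | succ n ih =>
    obtain ⟨x, rfl⟩ := Ext.contravariant_sequence_exact₃ hS _ e
      (Ext.eq_zero_of_projective (P := P.X i) _) (add_comm 1 (n + 1))
    rw [ih (i + 1) x (shortExact_cokernel_of_exactAt P _ (hP.acyclic _)) (hP.projective _),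
      Ext.comp_zero]

lemma IsGorensteinProjective.ext_eq_zero {G : C} (hG : IsGorensteinProjective G)
    (Q : C) [Projective Q] (n : ℕ) (e : Ext G Q (n + 1)) : e = 0 := by
  obtain ⟨P, hP, ⟨φ⟩⟩ := hG
  rw [← e.mk₀_id_comp, ← φ.hom_inv_id, ← Ext.mk₀_comp_mk₀, Ext.comp_assoc_of_second_deg_zero,
    hP.ext_cokernel_eq_zero Q n 0 ((Ext.mk₀ φ.inv).comp e (zero_add _)), Ext.comp_zero]

lemma HasResDimLE.ext_eq_zero {X : C} {m : ℕ} (hX : HasResDimLE IsGorensteinProjective X m)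
    (Q : C) [Projective Q] {n : ℕ} (hn : m < n) (e : Ext X Q n) : e = 0 := by
  induction hX generalizing n with
  | of_mem hX m =>
    obtain ⟨n, rfl⟩ := Nat.exists_eq_add_one_of_ne_zero (by lia : n ≠ 0)
    exact hX.ext_eq_zero Q n e
  | step m f g hses hG _ ih =>
    obtain ⟨n, rfl⟩ := Nat.exists_eq_add_one_of_ne_zero (by lia : n ≠ 0)
    obtain ⟨_, hS⟩ := hses
    obtain ⟨x, rfl⟩ := Ext.contravariant_sequence_exact₃ hS _ e
      (hG.ext_eq_zero Q n _) (add_comm 1 n)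
    rw [ih (by lia) x, Ext.comp_zero]

/-- If `X` has finite projective dimension, then `Ext^j(X, -)` vanishes for all `j > m` as soon
as it does so on projective objects. -/
lemma hasProjectiveDimensionLE_of_ext_projective [EnoughProjectives C] (X : C) (m n : ℕ)
    [HasProjectiveDimensionLE X n]
    (h : ∀ (Q : C) [Projective Q] (j : ℕ), m < j → ∀ e : Ext X Q j, e = 0) :
    HasProjectiveDimensionLE X m := by
  suffices ∀ (k j : ℕ), m < j → n < j + k → ∀ (Y : C) (e : Ext X Y j), e = 0 from
    HasProjectiveDimensionLT.mk fun j hj Y e ↦ this (n + 1) j hj (by lia) Y e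
  intro k
  induction k with
  | zero => exact fun j _ hj Y e ↦ e.eq_zero_of_hasProjectiveDimensionLT (n + 1) hj
  | succ k ih =>
    intro j hmj hnj Y e
    have hS : (ShortComplex.mk (kernel.ι (Projective.π Y)) (Projective.π Y)
        (kernel.condition _)).ShortExact := { exact := ShortComplex.exact_kernel _ }
    obtain ⟨x, rfl⟩ := Ext.covariant_sequence_exact₃ X hS e rfl
      (ih (j + 1) (by lia) (by lia) _ _)
    rw [h (Projective.over Y) j hmj x, Ext.zero_comp]

lemma hasProjectiveDimensionLE_iff_subsingleton_ext (X : C) (m : ℕ) :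
    HasProjectiveDimensionLE X m ↔
      ∀ (Y : C) (j : ℕ), m < j → Subsingleton (Ext X Y j) :=
  ⟨fun _ Y j hj ↦ HasProjectiveDimensionLT.subsingleton X (m + 1) j hj Y,
    fun h ↦ HasProjectiveDimensionLT.mk fun j hj Y _ ↦ (h Y j hj).elim _ _⟩

end Helpers

/-- The G-dimension refines the projective dimension. -/
theorem gdim_le_projDim {C : Type u} [Category.{v} C] [Abelian C]
    [EnoughProjectives C] [HasExt.{w} C] (X : C) :
    gDim X ≤ projDim X ∧ (projDim X ≠ ⊤ → gDim X = projDim X) := by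
  have hle : gDim X ≤ projDim X := by
    refine le_sInf ?_
    rintro _ ⟨m, rfl, hm⟩
    have := (hasProjectiveDimensionLE_iff_subsingleton_ext X m).2 hm
    exact sInf_le ⟨m, rfl, (hasResDimLE_projective m X).mono_s12
      fun P (_ : Projective P) ↦ isGorensteinProjective_of_projective P⟩
  refine ⟨hle, fun hfin ↦ le_antisymm hle (le_sInf ?_)⟩
  rintro _ ⟨m, rfl, hm⟩
  obtain ⟨_, ⟨n, rfl, hn⟩, -⟩ := sInf_lt_iff.1 (lt_top_iff_ne_top.2 hfin)
  have := (hasProjectiveDimensionLE_iff_subsingleton_ext X n).2 hn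
  have := hasProjectiveDimensionLE_of_ext_projective X m n
    fun Q _ _ hj e ↦ hm.ext_eq_zero Q hj e
  exact sInf_le ⟨m, rfl, (hasProjectiveDimensionLE_iff_subsingleton_ext X m).1 this⟩
end
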